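/- Let C : f = 0 be a reduced plane curve of degree d ≥ 3 in P²(ℂ), not the union of d lines through one point, and let r = mdr(f). Then τ(C) = (d−1)² − r(d−r−1) if and only if C is a free curve; moreover, in that case 2r < d. -/

import Mathlib

open MvPolynomial

noncomputable section

/-- `S = ℂ[x,y,z]`, with `x = X 0`, `y = X 1`, `z = X 2`. -/
abbrev S3 := MvPolynomial (Fin 3) ℂ

/-- The graded `S`-module `D_0(f)` of Jacobian syzygies of `f`. -/
def jacSyz (f : S3) : Submodule S3 (Fin 3 → S3) where
  carrier := {v | v 0 * pderiv 0 f + v 1 * pderiv 1 f + v 2 * pderiv 2 f = 0}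
  add_mem' := by
    intro a b ha hb
    simp only [Set.mem_setOf_eq, Pi.add_apply] at *
    linear_combination ha + hb
  zero_mem' := by simp
  smul_mem' := by
    intro c v hv
    simp only [Set.mem_setOf_eq, Pi.smul_apply, smul_eq_mul] at *
    linear_combination c * hv

/-- `v` is a minimal system of `m` homogeneous generators of `D_0(f)`, the generator
`v j` being a syzygy of degree `dd j`, and `dd` nondecreasing: this says that
`C : f = 0` is an `m`-syzygy curve with exponents `dd`. -/
structure IsMinGenSyz (f : S3) (m : ℕ) (dd : Fin m → ℕ) (v : Fin m → (Fin 3 → S3)) : Prop where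
  mem : ∀ j, v j ∈ jacSyz f
  hom : ∀ j i, ((v j) i).IsHomogeneous (dd j)
  ne_zero : ∀ j, v j ≠ 0
  span_eq : Submodule.span S3 (Set.range v) = jacSyz f
  minimal : ∀ j, v j ∉ Submodule.span S3 (v '' {j' | j' ≠ j})
  mono : Monotone dd

/-- `C : f = 0` is free with exponents `(d1, d2)`. -/
def IsFreeWith (f : S3) (d1 d2 : ℕ) : Prop := ∃ v, IsMinGenSyz f 2 ![d1, d2] v

/-- `C : f = 0` is a free curve (a 2-syzygy curve). -/
def IsFreeCurve (f : S3) : Prop := ∃ d1 d2, IsFreeWith f d1 d2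

/-- `C : f = 0` of degree `d` is nearly free with exponents `(d1, d2)`:
a 3-syzygy curve with exponents `(d1, d2, d2)` and `d1 + d2 = d`. -/
def IsNearlyFreeWith (f : S3) (d d1 d2 : ℕ) : Prop :=
  d1 + d2 = d ∧ ∃ v, IsMinGenSyz f 3 ![d1, d2, d2] v

/-- `C : f = 0` of degree `d` is a nearly free curve. -/
def IsNearlyFree (f : S3) (d : ℕ) : Prop := ∃ d1 d2, IsNearlyFreeWith f d d1 d2

/-- `C : f = 0` of degree `d` is plus-one generated with exponents `(d1, d2, d3)`:
a 3-syzygy curve with `d1 + d2 = d`. -/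
def IsPOGWith (f : S3) (d d1 d2 d3 : ℕ) : Prop :=
  d1 + d2 = d ∧ ∃ v, IsMinGenSyz f 3 ![d1, d2, d3] v

/-- `C : f = 0` of degree `d` is a plus-one generated curve. -/
def IsPOG (f : S3) (d : ℕ) : Prop := ∃ d1 d2 d3, IsPOGWith f d d1 d2 d3

/-- `C : f = 0` of degree `d` is minimal plus-one generated (MPOG),
with exponents `(d1, d2, d2 + 1)`. -/
def IsMPOGWith (f : S3) (d d1 d2 : ℕ) : Prop := IsPOGWith f d d1 d2 (d2 + 1)

/-- `C : f = 0` of degree `d` is an MPOG-curve. -/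
def IsMPOG (f : S3) (d : ℕ) : Prop := ∃ d1 d2, IsMPOGWith f d d1 d2

/-- `r = mdr(f)`: the minimal degree of a nonzero (homogeneous) Jacobian relation for `f`. -/
def IsMDR (f : S3) (r : ℕ) : Prop :=
  (∃ v ∈ jacSyz f, v ≠ 0 ∧ ∀ i, (v i).IsHomogeneous r) ∧
  ∀ m, m < r → ∀ v ∈ jacSyz f, (∀ i, (v i).IsHomogeneous m) → v = 0

/-- The Jacobian ideal `J_f` of `f`. -/
def jacobianIdeal (f : S3) : Ideal S3 := Ideal.span {pderiv 0 f, pderiv 1 f, pderiv 2 f}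

/-- The dimension of the degree `k` graded piece of the Milnor algebra `M(f) = S/J_f`. -/
def milnorDim (f : S3) (k : ℕ) : ℕ :=
  Module.finrank ℂ
    (↥(homogeneousSubmodule (Fin 3) ℂ k) ⧸
      (Submodule.comap (homogeneousSubmodule (Fin 3) ℂ k).subtype
        (Submodule.restrictScalars ℂ (jacobianIdeal f))))

/-- `τ` is the total Tjurina number of the reduced curve `C : f = 0`, i.e. the degree of the
Jacobian ideal `J_f`: for all large `k` one has `dim M(f)_k = τ`. -/
def IsTjurina (f : S3) (τ : ℕ) : Prop := ∀ᶠ k in Filter.atTop, milnorDim f k = τ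

/-- `C : f = 0` is a maximal Tjurina curve of type `(d, r)`. -/
def IsMaxTjurina (f : S3) (d r : ℕ) : Prop :=
  IsMDR f r ∧ d ≤ 2 * r ∧
  ∃ τ : ℕ, IsTjurina f τ ∧
    (τ : ℤ) = ((d : ℤ) - 1) ^ 2 - r * ((d : ℤ) - r - 1) - (Nat.choose (2 * r + 2 - d) 2 : ℤ)

/-- `f` is a product of `d` linear forms all vanishing at a common point, i.e.
`C : f = 0` is the union of `d` lines passing through one point. -/
def IsUnionOfConcurrentLines (f : S3) (d : ℕ) : Prop :=
  ∃ (c : ℂ) (L : Fin d → Fin 3 → ℂ) (v : Fin 3 → ℂ), v ≠ 0 ∧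
    f = C c * ∏ j, (∑ i, C (L j i) * X i) ∧ ∀ j, (∑ i, L j i * v i) = 0

/-- The ideal `I_θ` generated by the 2×2 minors of the matrix with rows `(x,y,z)` and
`(a,b,c)`, defining the eigenscheme `Γ_θ` of the derivation `θ = a ∂_x + b ∂_y + c ∂_z`. -/
def eigenIdeal (a b c : S3) : Ideal S3 :=
  Ideal.span {X 1 * c - X 2 * b, X 2 * a - X 0 * c, X 0 * b - X 1 * a}

/-- The projective plane `ℙ²(ℂ)`. -/
abbrev Pt := Projectivization ℂ (Fin 3 → ℂ)

/-- The eigenscheme `Γ_θ` of `θ = a ∂_x + b ∂_y + c ∂_z` is 0-dimensional: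
its set of points in `ℙ²` is finite. -/
def EigenSchemeFinite (a b c : S3) : Prop :=
  {p : Pt | eval p.rep (X 1 * c - X 2 * b) = 0 ∧ eval p.rep (X 2 * a - X 0 * c) = 0 ∧
      eval p.rep (X 0 * b - X 1 * a) = 0}.Finite

lemma exists_smul_of_smul_eq {R ι : Type*} [CommRing R] [IsDomain R] [UniqueFactorizationMonoid R]
    {u w : ι → R} (hu : ∀ p, Prime p → ∃ i, ¬ p ∣ u i) {a : R} (ha : a ≠ 0) :
    ∀ b, (∀ i, a * w i = b * u i) → ∃ g : R, w = g • u := by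
  induction a using UniqueFactorizationMonoid.induction_on_prime with
  | h₁ => exact absurd rfl ha
  | h₂ x hx =>
    obtain ⟨x, rfl⟩ := hx
    intro b h
    refine ⟨↑x⁻¹ * b, funext fun i => ?_⟩
    simp [mul_assoc, ← h i]
  | h₃ a p ha0 hp ih =>
    intro b h
    obtain ⟨i, hi⟩ := hu p hp
    have hb : p ∣ b := (hp.dvd_or_dvd ⟨a * w i, by rw [← h i, mul_assoc]⟩).resolve_right hi
    obtain ⟨b, rfl⟩ := hb
    exact ih ha0 b fun j => mul_left_cancel₀ hp.ne_zero (by rw [← mul_assoc, h j, mul_assoc])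

lemma homogeneousComponent_add_mul {σ R : Type*} [CommSemiring R] {p q : MvPolynomial σ R} {e : ℕ}
    (hq : q.IsHomogeneous e) (k : ℕ) :
    homogeneousComponent (k + e) (p * q) = homogeneousComponent k p * q := by
  conv_lhs => rw [← sum_homogeneousComponent p, Finset.sum_mul, map_sum]
  rw [Finset.sum_congr rfl fun i _ => homogeneousComponent_of_mem (m := k + e)
    ((homogeneousComponent_isHomogeneous i p).mul hq)]
  simp only [add_left_inj, eq_comm (a := k)]
  rw [Finset.sum_ite_eq']
  split_ifs with h
  · rfl
  · rw [homogeneousComponent_eq_zero _ _ (by simpa using h), zero_mul]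

lemma homogeneousComponent_mul_of_lt {σ R : Type*} [CommSemiring R] {p q : MvPolynomial σ R}
    {e k : ℕ} (hq : q.IsHomogeneous e) (hk : k < e) : homogeneousComponent k (p * q) = 0 := by
  rw [← sum_homogeneousComponent p, Finset.sum_mul, map_sum]
  refine Finset.sum_eq_zero fun i _ => ?_
  rw [homogeneousComponent_of_mem ((homogeneousComponent_isHomogeneous i p).mul hq), if_neg]
  omega

lemma isHomogeneous_of_mul {σ R : Type*} [CommRing R] [IsDomain R] {p q : MvPolynomial σ R}
    {n e : ℕ} (hq : q.IsHomogeneous e) (hq0 : q ≠ 0) (h : (p * q).IsHomogeneous (n + e)) :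
    p.IsHomogeneous n := by
  have := homogeneousComponent_add_mul (p := p) hq n
  rw [homogeneousComponent_eq_self h] at this
  rw [mul_right_cancel₀ hq0 this]
  exact homogeneousComponent_isHomogeneous n p

lemma finrank_homogeneousSubmodule (n : ℕ) :
    Module.finrank ℂ (homogeneousSubmodule (Fin 3) ℂ n) = (n + 2).choose 2 := by
  classical
  have hspan : homogeneousSubmodule (Fin 3) ℂ n = Submodule.span ℂ (Set.range
      fun s : Finset.finsuppAntidiag (Finset.univ : Finset (Fin 3)) n =>
        (basisMonomials (Fin 3) ℂ) s.1) := by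
    rw [homogeneousSubmodule_eq_finsupp_supported, AddMonoidAlgebra.supported_eq_span_single]
    congr 1
    ext x
    simp [Finsupp.degree_eq_sum, single_eq_monomial]
  rw [hspan]
  refine (finrank_span_eq_card
    ((basisMonomials (Fin 3) ℂ).linearIndependent.comp _ Subtype.val_injective)).trans ?_
  rw [Fintype.card_coe, Finset.card_finsuppAntidiag_nat_eq_choose]
  simp only [Finset.card_univ, Fintype.card_fin]
  rw [show 3 + n - 1 = n + 2 by omega, ← Nat.choose_symm_add]

lemma X_dvd_sub_aeval_update (i : Fin 3) (p : S3) :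
    X i ∣ p - aeval (Function.update (X : Fin 3 → S3) i 0) p := by
  induction p using MvPolynomial.induction_on with
  | C a => simp
  | add p q hp hq => simpa [add_sub_add_comm] using dvd_add hp hq
  | mul_X p j hp =>
    rw [map_mul, aeval_X]
    by_cases hj : j = i
    · subst hj; simp
    · rw [Function.update_of_ne hj, ← sub_mul]
      exact hp.mul_right _

lemma koszul_exact {α β γ : S3} (h : X 2 * α + X 0 * β + X 1 * γ = 0) :
    ∃ a b c : S3, α = X 0 * b - X 1 * a ∧ β = X 1 * c - X 2 * b ∧ γ = X 2 * a - X 0 * c := by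
  set s : S3 →ₐ[ℂ] S3 := aeval (Function.update (X : Fin 3 → S3) 2 0) with hs
  obtain ⟨b, hb⟩ := X_dvd_sub_aeval_update 2 β
  obtain ⟨a, ha⟩ := X_dvd_sub_aeval_update 2 γ
  rw [← hs] at ha hb
  have h1 : X 0 * s β + X 1 * s γ = 0 := by
    have := congrArg s h
    simpa [hs, Function.update_of_ne] using this
  have h01 : ¬ (X 1 : S3) ∣ X 0 := by simp [X_dvd_X]
  obtain ⟨c, hc⟩ : X 1 ∣ s β :=
    (X_dvd_mul_iff.1 (⟨- s γ, by linear_combination h1⟩ : X 1 ∣ X 0 * s β)).resolve_left h01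
  have hc' : s γ = - X 0 * c :=
    mul_left_cancel₀ (X_ne_zero 1 : (X 1 : S3) ≠ 0) (by linear_combination h1 - X 0 * hc)
  refine ⟨a, -b, c, ?_, by linear_combination hb + hc, by linear_combination ha + hc'⟩
  exact mul_left_cancel₀ (X_ne_zero 2 : (X 2 : S3) ≠ 0)
    (by linear_combination h - X 0 * (hb + hc) - X 1 * (ha + hc'))

lemma totalDegree_pderiv_lt {σ R : Type*} [CommSemiring R] {p : MvPolynomial σ R} {i : σ}
    (h : pderiv i p ≠ 0) : (pderiv i p).totalDegree < p.totalDegree := by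
  classical
  obtain ⟨m, hm, hdeg⟩ := Finset.exists_mem_eq_sup _ (support_nonempty.2 h)
    (fun m : σ →₀ ℕ => m.sum fun _ e => e)
  have hmem : m + Finsupp.single i 1 ∈ p.support := by
    rw [mem_support_iff] at hm ⊢
    exact fun h0 => hm (by rw [coeff_pderiv, h0, zero_mul])
  have hle := le_totalDegree hmem
  rw [Finsupp.sum_add_index' (fun _ => rfl) (fun _ _ _ => rfl), Finsupp.sum_single_index rfl] at hle
  rw [totalDegree, hdeg]
  exact hle

lemma isUnit_of_dvd_pderiv {σ K : Type*} [Field K] [CharZero K] {p : MvPolynomial σ K}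
    (hp : p ≠ 0) (h : ∀ i, p ∣ pderiv i p) : IsUnit p := by
  have h0 : ∀ i, pderiv i p = 0 := fun i => by
    by_contra hne
    exact (totalDegree_pderiv_lt hne).not_ge (totalDegree_le_of_dvd_of_isDomain (h i) hne)
  have hdeg : p.totalDegree = 0 := by
    rw [totalDegree_eq_zero_iff]
    intro m hm i
    by_contra hmi
    have := coeff_pderiv (i := i) p (m - Finsupp.single i 1)
    rw [h0, coeff_zero, tsub_add_cancel_of_le (by simpa using Nat.one_le_iff_ne_zero.2 hmi)] at this
    rcases mul_eq_zero.1 this.symm with h1 | h1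
    · exact mem_support_iff.1 hm h1
    · exact Nat.cast_add_one_ne_zero _ h1
  rw [totalDegree_eq_zero_iff_eq_C] at hdeg
  rw [hdeg]
  refine (IsUnit.mk0 _ fun hc => hp ?_).map C
  rw [hdeg, hc, C_0]

/-- The gradient vector `(f_x, f_y, f_z)`. -/
def polyGradient (f : S3) : Fin 3 → S3 := fun i => pderiv i f

lemma mem_jacSyz {f : S3} {v : Fin 3 → S3} : v ∈ jacSyz f ↔ ∑ i, v i * pderiv i f = 0 := by
  rw [Fin.sum_univ_three]
  rfl

lemma homogeneousComponent_mem_jacSyz {f : S3} {d : ℕ} (hf : f.IsHomogeneous d) {v : Fin 3 → S3}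
    (hv : v ∈ jacSyz f) (m : ℕ) : (fun i => homogeneousComponent m (v i)) ∈ jacSyz f := by
  rw [mem_jacSyz] at hv ⊢
  simpa [homogeneousComponent_add_mul hf.pderiv] using
    congrArg (homogeneousComponent (m + (d - 1))) hv

lemma mem_jacSyz_of_smul_mem {f a : S3} (ha : a ≠ 0) {v : Fin 3 → S3} (h : a • v ∈ jacSyz f) :
    v ∈ jacSyz f := by
  rw [mem_jacSyz] at h ⊢
  refine (mul_eq_zero.1 (?_ : a * _ = 0)).resolve_left ha
  simpa [Finset.mul_sum, mul_assoc] using h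

/-- The partial derivatives of a squarefree form have no common prime factor. -/
lemma exists_not_dvd_gradient {f : S3} {d : ℕ} (hd : d ≠ 0) (hf : f.IsHomogeneous d)
    (hred : Squarefree f) (p : S3) (hp : Prime p) : ∃ i, ¬ p ∣ polyGradient f i := by
  by_contra! hdvd
  have hpf : p ∣ f := by
    have h1 : p ∣ d • f := hf.sum_X_mul_pderiv ▸
      Finset.dvd_sum fun i _ => (hdvd i).mul_left (X i)
    have h2 : f = C ((d : ℂ)⁻¹) * d • f := by
      rw [nsmul_eq_mul, ← mul_assoc, ← map_natCast (C : ℂ →+* S3), ← C_mul,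
        inv_mul_cancel₀ (Nat.cast_ne_zero.2 hd), C_1, one_mul]
    rw [h2]
    exact h1.mul_left _
  obtain ⟨q, rfl⟩ := hpf
  have hq : ¬ p ∣ q := fun h => hp.not_isUnit (hred p (mul_dvd_mul_left p h))
  refine hp.not_isUnit (isUnit_of_dvd_pderiv hp.ne_zero fun i => ?_)
  have h1 := hdvd i
  rw [polyGradient, pderiv_mul, dvd_add_left (dvd_mul_right _ _)] at h1
  exact (hp.dvd_or_dvd h1).resolve_right hq

/-- A nonzero syzygy of minimal degree has no common prime factor. -/
lemma exists_not_dvd_of_isMDR {f : S3} {d r : ℕ} (hf : f.IsHomogeneous d)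
    (hmdr : IsMDR f r) {ρ : Fin 3 → S3} (hρ : ρ ∈ jacSyz f) (hρ0 : ρ ≠ 0)
    (hρr : ∀ i, (ρ i).IsHomogeneous r) (p : S3) (hp : Prime p) : ∃ i, ¬ p ∣ ρ i := by
  by_contra! hdvd
  choose v hv using hdvd
  obtain rfl : ρ = p • v := funext hv
  have hvmem := mem_jacSyz_of_smul_mem hp.ne_zero hρ
  have hpdeg : p.totalDegree ≠ 0 := fun h => by
    rw [totalDegree_eq_zero_iff_eq_C] at h
    refine hp.not_isUnit ?_
    rw [h]
    exact (IsUnit.mk0 _ fun hc => hp.ne_zero (by rw [h, hc, C_0])).map C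
  apply hρ0
  suffices v = 0 by rw [this, smul_zero]
  funext i
  by_contra hvi
  have hdeg := (hρr i).totalDegree (mul_ne_zero hp.ne_zero hvi)
  rw [Pi.smul_apply, smul_eq_mul, totalDegree_mul_of_isDomain hp.ne_zero hvi] at hdeg
  apply hvi
  rw [← sum_homogeneousComponent (v i)]
  refine Finset.sum_eq_zero fun m hm => ?_
  rw [Finset.mem_range] at hm
  exact congrFun (hmdr.2 m (by omega) _ (homogeneousComponent_mem_jacSyz hf hvmem m)
    fun i => homogeneousComponent_isHomogeneous m (v i)) i

/-- A vector with zero cross product with a primitive vector is a multiple of it. -/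
lemma exists_smul_of_cross_eq_zero {u w : Fin 3 → S3} (hu : ∀ p, Prime p → ∃ i, ¬ p ∣ u i)
    (h : crossProduct u w = 0) : ∃ g : S3, w = g • u := by
  obtain ⟨j, hj⟩ := hu (X 0) (X_prime (R := ℂ) (i := (0 : Fin 3)))
  have h0 := congrFun h 0
  have h1 := congrFun h 1
  have h2 := congrFun h 2
  simp only [cross_apply, Matrix.cons_val, Pi.zero_apply] at h0 h1 h2
  refine exists_smul_of_smul_eq hu (a := u j) (fun h => hj (h ▸ dvd_zero _)) (w j) fun i => ?_
  fin_cases i <;> fin_cases j <;> simp only [Fin.reduceFinMk, Fin.zero_eta, Fin.mk_one] <;> grind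

/-- The map `h` with `ρ × v = h(v) ∇f` on Jacobian syzygies `v`. -/
lemma exists_cross_eq_smul_gradient {f : S3} (hf : ∀ p, Prime p → ∃ i, ¬ p ∣ polyGradient f i)
    {ρ : Fin 3 → S3} (hρ : ρ ∈ jacSyz f) :
    ∃ h : jacSyz f →ₗ[S3] S3, ∀ v, crossProduct ρ v.1 = h v • polyGradient f := by
  have key : ∀ v : jacSyz f, ∃ g : S3, crossProduct ρ v.1 = g • polyGradient f := by
    rintro ⟨v, hv⟩
    refine exists_smul_of_cross_eq_zero hf ?_
    rw [mem_jacSyz, Fin.sum_univ_three] at hv hρ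
    ext1 i
    fin_cases i <;> simp [cross_apply, polyGradient] <;> grind
  choose h hh using key
  have h0 : polyGradient f ≠ 0 := by
    obtain ⟨j, hj⟩ := hf (X 0) (X_prime (R := ℂ) (i := (0 : Fin 3)))
    exact fun h => hj (h ▸ dvd_zero _)
  have inj := smul_left_injective S3 h0
  refine ⟨⟨⟨h, fun v w => inj ?_⟩, fun a v => inj ?_⟩, hh⟩
  · simp only [add_smul, ← hh, Submodule.coe_add, map_add]
  · simp only [smul_eq_mul, mul_smul, ← hh, Submodule.coe_smul, map_smul, RingHom.id_apply]

lemma eq_zero_iff_of_cross_eq_smul {f : S3} {ρ : Fin 3 → S3} (hf : polyGradient f ≠ 0)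
    (hρ : ∀ p, Prime p → ∃ i, ¬ p ∣ ρ i)
    {h : jacSyz f →ₗ[S3] S3} (hh : ∀ v, crossProduct ρ v.1 = h v • polyGradient f)
    (v : jacSyz f) : h v = 0 ↔ ∃ a : S3, v.1 = a • ρ := by
  constructor
  · intro h0
    exact exists_smul_of_cross_eq_zero hρ (by rw [hh, h0, zero_smul])
  · rintro ⟨a, ha⟩
    have := hh v
    rw [ha, map_smul, cross_self, smul_zero] at this
    exact (smul_eq_zero.1 this.symm).resolve_right hf

/-- The image of `h` is saturated with respect to the irrelevant ideal. -/
lemma mem_range_of_X_mul_mem {f : S3} {ρ : Fin 3 → S3} (hρ0 : ρ ≠ 0) (hρmem : ρ ∈ jacSyz f)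
    {h : jacSyz f →ₗ[S3] S3} (hker : ∀ v : jacSyz f, h v = 0 ↔ ∃ a : S3, v.1 = a • ρ)
    {g : S3} (hg : ∀ i, X i * g ∈ LinearMap.range h) : g ∈ LinearMap.range h := by
  obtain ⟨u, hu⟩ := hg 0
  obtain ⟨v, hv⟩ := hg 1
  obtain ⟨w, hw⟩ := hg 2
  obtain ⟨α, hα⟩ := (hker ((X 0 : S3) • v - (X 1 : S3) • u)).1 (by
    rw [map_sub, map_smul, map_smul, hu, hv, smul_eq_mul, smul_eq_mul]; ring)
  obtain ⟨β, hβ⟩ := (hker ((X 1 : S3) • w - (X 2 : S3) • v)).1 (by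
    rw [map_sub, map_smul, map_smul, hw, hv, smul_eq_mul, smul_eq_mul]; ring)
  obtain ⟨γ, hγ⟩ := (hker ((X 2 : S3) • u - (X 0 : S3) • w)).1 (by
    rw [map_sub, map_smul, map_smul, hu, hw, smul_eq_mul, smul_eq_mul]; ring)
  have hα' : ∀ i, X 0 * v.1 i - X 1 * u.1 i = α * ρ i := fun i => congrFun hα i
  have hβ' : ∀ i, X 1 * w.1 i - X 2 * v.1 i = β * ρ i := fun i => congrFun hβ i
  have hγ' : ∀ i, X 2 * u.1 i - X 0 * w.1 i = γ * ρ i := fun i => congrFun hγ i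
  obtain ⟨j, hj⟩ := Function.ne_iff.1 hρ0
  obtain ⟨a, b, c, rfl, rfl, rfl⟩ := koszul_exact (α := α) (β := β) (γ := γ)
    (mul_right_cancel₀ hj (by
      linear_combination -X 2 * hα' j - X 0 * hβ' j - X 1 * hγ' j))
  have h01 : ¬ (X 0 : S3) ∣ X 1 := by simp [X_dvd_X]
  have hdvd : ∀ i, X 0 ∣ u.1 i - a * ρ i := fun i =>
    (X_dvd_mul_iff.1 (⟨v.1 i - b * ρ i, by linear_combination -hα' i⟩ :
      X 0 ∣ X 1 * (u.1 i - a * ρ i))).resolve_left h01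
  choose t ht using hdvd
  have hXt : (X 0 : S3) • t = u.1 - a • ρ := funext fun i => (ht i).symm
  have htmem : t ∈ jacSyz f := by
    refine mem_jacSyz_of_smul_mem (X_ne_zero (0 : Fin 3) : (X 0 : S3) ≠ 0) ?_
    rw [hXt]
    exact sub_mem u.2 ((jacSyz f).smul_mem a hρmem)
  refine ⟨⟨t, htmem⟩, mul_left_cancel₀ (X_ne_zero (0 : Fin 3) : (X 0 : S3) ≠ 0) ?_⟩
  have : (X 0 : S3) • (⟨t, htmem⟩ : jacSyz f) = u - a • ⟨ρ, hρmem⟩ := Subtype.ext hXt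
  rw [← hu, ← smul_eq_mul, ← map_smul, this, map_sub, map_smul,
    (hker ⟨ρ, hρmem⟩).2 ⟨1, (one_smul _ _).symm⟩, smul_zero, sub_zero]

lemma one_mem_range_of_homogeneousSubmodule {f : S3} {ρ : Fin 3 → S3} (hρ0 : ρ ≠ 0)
    (hρmem : ρ ∈ jacSyz f)
    {h : jacSyz f →ₗ[S3] S3} (hker : ∀ v : jacSyz f, h v = 0 ↔ ∃ a : S3, v.1 = a • ρ)
    {n : ℕ} (hn : ∀ g : S3, g.IsHomogeneous n → g ∈ LinearMap.range h) :
    (1 : S3) ∈ LinearMap.range h := by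
  induction n with
  | zero => exact hn 1 (isHomogeneous_one _ _)
  | succ n ih =>
    refine ih fun g hg => mem_range_of_X_mul_mem hρ0 hρmem hker fun i => hn _ ?_
    rw [add_comm]
    exact (isHomogeneous_X _ i).mul hg

/-- The degree `m` part of the map `v ↦ v · ∇f`. -/
def gradientPairing {f : S3} {e : ℕ} (hf : ∀ i, (pderiv i f).IsHomogeneous e) (m : ℕ) :
    (Fin 3 → homogeneousSubmodule (Fin 3) ℂ m) →ₗ[ℂ] homogeneousSubmodule (Fin 3) ℂ (m + e) :=
  LinearMap.codRestrict _
    (∑ i, LinearMap.mulRight ℂ (pderiv i f) ∘ₗ (homogeneousSubmodule (Fin 3) ℂ m).subtype ∘ₗ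
      LinearMap.proj i)
    fun v => by
      rw [LinearMap.sum_apply]
      exact sum_mem fun i _ => (v i).2.mul (hf i)

lemma coe_gradientPairing {f : S3} {e : ℕ} (hf : ∀ i, (pderiv i f).IsHomogeneous e) (m : ℕ)
    (v : Fin 3 → homogeneousSubmodule (Fin 3) ℂ m) :
    (gradientPairing hf m v : S3) = ∑ i, (v i : S3) * pderiv i f := by
  simp [gradientPairing]

instance finite_homogeneousSubmodule (n : ℕ) :
    Module.Finite ℂ (homogeneousSubmodule (Fin 3) ℂ n) :=
  Module.Finite.iff_fg.2 (homogeneousSubmodule_fg _ _ n)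

lemma range_gradientPairing {f : S3} {e : ℕ} (hf : ∀ i, (pderiv i f).IsHomogeneous e) (m : ℕ) :
    LinearMap.range (gradientPairing hf m) =
      Submodule.comap (homogeneousSubmodule (Fin 3) ℂ (m + e)).subtype
        (Submodule.restrictScalars ℂ (jacobianIdeal f)) := by
  ext ⟨q, hq⟩
  simp only [LinearMap.mem_range, Submodule.mem_comap, Submodule.subtype_apply,
    Submodule.restrictScalars_mem, jacobianIdeal, Subtype.ext_iff, coe_gradientPairing]
  constructor
  · rintro ⟨v, rfl⟩
    refine sum_mem fun i _ => Ideal.mul_mem_left _ _ (Ideal.subset_span ?_)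
    fin_cases i <;> simp
  · intro hJ
    obtain ⟨a, b, c, rfl⟩ := Submodule.mem_span_triple.1 hJ
    refine ⟨fun i => ⟨homogeneousComponent m (![a, b, c] i), homogeneousComponent_isHomogeneous _ _⟩,
      ?_⟩
    have h2 := congrArg (homogeneousComponent (m + e)) (rfl :
      a • pderiv 0 f + b • pderiv 1 f + c • pderiv 2 f = _)
    conv_rhs at h2 => rw [homogeneousComponent_eq_self hq]
    rw [← h2]
    simp [Fin.sum_univ_three, homogeneousComponent_add_mul (hf _)]

lemma milnorDim_add_three_mul {f : S3} {e : ℕ} (hf : ∀ i, (pderiv i f).IsHomogeneous e) (m : ℕ) :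
    milnorDim f (m + e) + 3 * (m + 2).choose 2 =
      (m + e + 2).choose 2 + Module.finrank ℂ (LinearMap.ker (gradientPairing hf m)) := by
  have h1 := LinearMap.finrank_range_add_finrank_ker (gradientPairing hf m)
  have h2 := Submodule.finrank_quotient_add_finrank (LinearMap.range (gradientPairing hf m))
  rw [Module.finrank_pi_fintype] at h1
  simp only [finrank_homogeneousSubmodule, Finset.sum_const, Finset.card_univ, Fintype.card_fin,
    smul_eq_mul] at h1 h2
  rw [range_gradientPairing] at h1 h2
  unfold milnorDim
  omega

/-- The homogeneous syzygies of degree `m` inside the module of all syzygies. -/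
def kerToJacSyz {f : S3} {e : ℕ} (hf : ∀ i, (pderiv i f).IsHomogeneous e) (m : ℕ) :
    LinearMap.ker (gradientPairing hf m) →ₗ[ℂ] jacSyz f where
  toFun v := ⟨fun i => (v.1 i : S3), by
    rw [mem_jacSyz, ← coe_gradientPairing hf, LinearMap.mem_ker.1 v.2]
    rfl⟩
  map_add' _ _ := rfl
  map_smul' _ _ := rfl

lemma exists_kerToJacSyz_eq {f : S3} {e : ℕ} (hf : ∀ i, (pderiv i f).IsHomogeneous e) {m : ℕ}
    (v : jacSyz f) (hv : ∀ i, (v.1 i).IsHomogeneous m) : ∃ w, kerToJacSyz hf m w = v := by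
  refine ⟨⟨fun i => ⟨v.1 i, hv i⟩, ?_⟩, rfl⟩
  rw [LinearMap.mem_ker, Subtype.ext_iff, coe_gradientPairing]
  exact mem_jacSyz.1 v.2

lemma isHomogeneous_cross {u v : Fin 3 → S3} {m n : ℕ} (hu : ∀ i, (u i).IsHomogeneous m)
    (hv : ∀ i, (v i).IsHomogeneous n) (i : Fin 3) :
    (crossProduct u v i).IsHomogeneous (m + n) := by
  rw [cross_apply]
  fin_cases i <;> exact ((hu _).mul (hv _)).sub ((hu _).mul (hv _))

/-- The image of the degree `m` part of `h` is everything in degree `n = m + r - e`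
exactly when the degree `m` syzygies have the largest possible dimension. -/
lemma finrank_ker_gradientPairing_eq_iff {f : S3} {e r l n : ℕ}
    (hf : ∀ i, (pderiv i f).IsHomogeneous e) (hf0 : polyGradient f ≠ 0)
    {ρ : Fin 3 → S3} (hρ0 : ρ ≠ 0) (hρmem : ρ ∈ jacSyz f) (hρr : ∀ i, (ρ i).IsHomogeneous r)
    {h : jacSyz f →ₗ[S3] S3} (hh : ∀ v, crossProduct ρ v.1 = h v • polyGradient f)
    (hker : ∀ v : jacSyz f, h v = 0 ↔ ∃ a : S3, v.1 = a • ρ) (hn : n + e = r + (l + r)) :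
    Module.finrank ℂ (LinearMap.ker (gradientPairing hf (l + r))) =
      (l + 2).choose 2 + (n + 2).choose 2 ↔
    ∀ g : S3, g.IsHomogeneous n → ∃ v : jacSyz f, (∀ i, (v.1 i).IsHomogeneous (l + r)) ∧ h v = g := by
  obtain ⟨j, hj⟩ := Function.ne_iff.1 hf0
  obtain ⟨k, hk⟩ := Function.ne_iff.1 hρ0
  let ψ : LinearMap.ker (gradientPairing hf (l + r)) →ₗ[ℂ] homogeneousSubmodule (Fin 3) ℂ n :=
    LinearMap.codRestrict _ (h.restrictScalars ℂ ∘ₗ kerToJacSyz hf (l + r)) fun v => by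
      refine isHomogeneous_of_mul (hf j) hj ?_
      have hc := isHomogeneous_cross hρr (v := (kerToJacSyz hf (l + r) v).1)
        (fun i => (v.1 i).2) j
      rw [hh] at hc
      rw [hn]
      exact hc
  let χ : homogeneousSubmodule (Fin 3) ℂ l →ₗ[ℂ] jacSyz f :=
    ((LinearMap.toSpanSingleton S3 (jacSyz f) ⟨ρ, hρmem⟩).restrictScalars ℂ) ∘ₗ
      (homogeneousSubmodule (Fin 3) ℂ l).subtype
  have hχ : ∀ a, (χ a).1 = a.1 • ρ := fun a => rfl
  have hχinj : Function.Injective χ := by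
    intro a b hab
    have := congrFun (congrArg Subtype.val hab) k
    exact Subtype.ext (mul_right_cancel₀ hk this)
  have hinj : Function.Injective (kerToJacSyz hf (l + r)) := by
    intro a b hab
    refine Subtype.ext (funext fun i => Subtype.ext ?_)
    exact congrFun (congrArg Subtype.val hab) i
  have hψ : ∀ v, (ψ v).1 = h (kerToJacSyz hf (l + r) v) := fun v => rfl
  have hrange : (LinearMap.ker ψ).map (kerToJacSyz hf (l + r)) = LinearMap.range χ := by
    ext v
    simp only [Submodule.mem_map, LinearMap.mem_ker, LinearMap.mem_range, Subtype.ext_iff, hψ]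
    constructor
    · rintro ⟨w, hw, hwv⟩
      obtain ⟨a, ha⟩ := (hker _).1 hw
      have hal : a.IsHomogeneous l := by
        refine isHomogeneous_of_mul (hρr k) hk ?_
        have hwk : ((kerToJacSyz hf (l + r) w).1 k).IsHomogeneous (l + r) := (w.1 k).2
        rw [ha] at hwk
        exact hwk
      exact ⟨⟨a, hal⟩, by rw [hχ, ← hwv, ha]⟩
    · rintro ⟨a, ha⟩
      rw [hχ] at ha
      obtain ⟨w, hw⟩ := exists_kerToJacSyz_eq hf (m := l + r) v fun i => by
        rw [← ha]; exact a.2.mul (hρr i)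
      exact ⟨w, by rw [hw]; exact (hker v).2 ⟨a.1, ha.symm⟩, by rw [hw]⟩
  have hdim : Module.finrank ℂ (LinearMap.ker ψ) = (l + 2).choose 2 := by
    rw [LinearEquiv.finrank_eq (Submodule.equivMapOfInjective _ hinj (LinearMap.ker ψ)), hrange,
      LinearMap.finrank_range_of_inj hχinj, finrank_homogeneousSubmodule]
  have hrank := LinearMap.finrank_range_add_finrank_ker (K := ℂ)
    (V := LinearMap.ker (gradientPairing hf (l + r))) (V₂ := homogeneousSubmodule (Fin 3) ℂ n) ψ
  rw [hdim, add_comm] at hrank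
  rw [← hrank, add_right_inj,
    ← finrank_homogeneousSubmodule n]
  constructor
  · intro heq g hg
    have htop := Submodule.eq_top_of_finrank_eq heq
    obtain ⟨w, hw⟩ := LinearMap.range_eq_top.1 htop ⟨g, hg⟩
    exact ⟨kerToJacSyz hf _ w, fun i => (w.1 i).2, by rw [← hψ, hw]⟩
  · intro hall
    rw [LinearMap.range_eq_top.2, finrank_top]
    rintro ⟨g, hg⟩
    obtain ⟨v, hv, rfl⟩ := hall g hg
    obtain ⟨w, rfl⟩ := exists_kerToJacSyz_eq hf v hv
    exact ⟨w, rfl⟩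

lemma two_mul_choose_two (n : ℕ) : 2 * ((n + 2).choose 2 : ℤ) = (n + 2) * (n + 1) := by
  have h := Nat.add_one_mul_choose_eq (n + 1) 1
  rw [Nat.choose_one_right] at h
  zify at h
  linear_combination -h

lemma homogeneousComponent_cross {u v : Fin 3 → S3} {m : ℕ} (hu : ∀ i, (u i).IsHomogeneous m)
    (k : ℕ) : crossProduct u (fun i => homogeneousComponent k (v i)) =
      fun i => homogeneousComponent (k + m) (crossProduct u v i) := by
  funext i
  fin_cases i <;>
    simp [cross_apply, mul_comm (u _), homogeneousComponent_add_mul (hu _)]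

/-- If `h` takes the value `1`, it does so on a homogeneous syzygy of degree `d - 1 - r`. -/
lemma exists_isHomogeneous_of_one_mem_range {f : S3} {d r : ℕ} (hf : f.IsHomogeneous d)
    (hf0 : polyGradient f ≠ 0)
    {ρ : Fin 3 → S3} (hρr : ∀ i, (ρ i).IsHomogeneous r)
    {h : jacSyz f →ₗ[S3] S3} (hh : ∀ v, crossProduct ρ v.1 = h v • polyGradient f)
    (h1 : (1 : S3) ∈ LinearMap.range h) :
    ∃ s, s + r = d - 1 ∧ ∃ v : jacSyz f, (∀ i, (v.1 i).IsHomogeneous s) ∧ h v = 1 := by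
  obtain ⟨v, hv⟩ := h1
  have hcross := hh v
  rw [hv, one_smul] at hcross
  obtain ⟨j, hj⟩ := Function.ne_iff.1 hf0
  have hgrad : ∀ i, homogeneousComponent (d - 1) (polyGradient f i) = polyGradient f i :=
    fun i => homogeneousComponent_eq_self hf.pderiv
  have hr : r ≤ d - 1 := by
    by_contra! hlt
    apply hj
    rw [← hgrad, ← hcross, cross_apply]
    fin_cases j <;> simp [mul_comm (ρ _), homogeneousComponent_mul_of_lt (hρr _) hlt]
  refine ⟨d - 1 - r, by omega, ⟨_, homogeneousComponent_mem_jacSyz hf v.2 (d - 1 - r)⟩,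
    fun i => homogeneousComponent_isHomogeneous _ _, smul_left_injective S3 hf0 ?_⟩
  simp only
  rw [← hh, one_smul, homogeneousComponent_cross hρr, Nat.sub_add_cancel hr, hcross]
  exact funext hgrad

/-- `τ(C) = (d-1)² - r(d-r-1)` exactly when `h` is surjective. -/
lemma tjurina_eq_iff {f : S3} {d r τ : ℕ} (hd : d ≠ 0) (hf : f.IsHomogeneous d)
    (hf0 : polyGradient f ≠ 0)
    {ρ : Fin 3 → S3} (hρ0 : ρ ≠ 0) (hρmem : ρ ∈ jacSyz f) (hρr : ∀ i, (ρ i).IsHomogeneous r)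
    {h : jacSyz f →ₗ[S3] S3} (hh : ∀ v, crossProduct ρ v.1 = h v • polyGradient f)
    (hker : ∀ v : jacSyz f, h v = 0 ↔ ∃ a : S3, v.1 = a • ρ) (htau : IsTjurina f τ) :
    (τ : ℤ) = ((d : ℤ) - 1) ^ 2 - r * ((d : ℤ) - r - 1) ↔ (1 : S3) ∈ LinearMap.range h := by
  obtain ⟨e, rfl⟩ := Nat.exists_eq_succ_of_ne_zero hd
  have hfe : ∀ i, (pderiv i f).IsHomogeneous e := fun i => hf.pderiv
  obtain ⟨N, hN⟩ := Filter.eventually_atTop.1 htau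
  set l := N + e with hl
  have hm := milnorDim_add_three_mul hfe (l + r)
  rw [hN (l + r + e) (by omega)] at hm
  have hiff := finrank_ker_gradientPairing_eq_iff (n := r + N + r) hfe hf0 hρ0 hρmem hρr hh hker
    (l := l) (by omega)
  have c1 := two_mul_choose_two (l + r)
  have c2 := two_mul_choose_two (l + r + e)
  have c3 := two_mul_choose_two l
  have c4 := two_mul_choose_two (r + N + r)
  have heq : (τ : ℤ) = (((e + 1 : ℕ) : ℤ) - 1) ^ 2 - r * (((e + 1 : ℕ) : ℤ) - r - 1) ↔
      Module.finrank ℂ (LinearMap.ker (gradientPairing hfe (l + r))) =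
        (l + 2).choose 2 + (r + N + r + 2).choose 2 := by
    zify at hm ⊢
    rw [hl] at *
    push_cast at *
    constructor <;> intro H <;> grind
  rw [Nat.succ_eq_add_one, heq, hiff]
  constructor
  · intro hall
    refine one_mem_range_of_homogeneousSubmodule hρ0 hρmem hker (n := r + N + r) fun g hg => ?_
    obtain ⟨v, -, hv⟩ := hall g hg
    exact ⟨v, hv⟩
  · intro h1 g hg
    obtain ⟨s, hs, v, hv, hv1⟩ := exists_isHomogeneous_of_one_mem_range hf hf0 hρr hh h1
    refine ⟨g • v, fun i => ?_, by rw [map_smul, hv1, smul_eq_mul, mul_one]⟩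
    have := hg.mul (hv i)
    rwa [show r + N + r + s = l + r by simp at hs; omega] at this

/-- Saito's criterion: if `ρ` and `v` generate the syzygies, then `h(v)` is a unit. -/
lemma one_mem_range_of_span_pair {f : S3} {ρ : Fin 3 → S3}
    (hρmem : ρ ∈ jacSyz f) (hρ : ∀ p, Prime p → ∃ i, ¬ p ∣ ρ i)
    {h : jacSyz f →ₗ[S3] S3} (hh : ∀ v, crossProduct ρ v.1 = h v • polyGradient f)
    (hker : ∀ v : jacSyz f, h v = 0 ↔ ∃ a : S3, v.1 = a • ρ)
    (v : jacSyz f) (hv : ∀ a : S3, v.1 ≠ a • ρ)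
    (hspan : ∀ w ∈ jacSyz f, ∃ a b : S3, a • ρ + b • v.1 = w) :
    (1 : S3) ∈ LinearMap.range h := by
  have hρ1 : h ⟨ρ, hρmem⟩ = 0 := (hker _).2 ⟨1, (one_smul _ _).symm⟩
  have hg0 : h v ≠ 0 := fun h0 => by
    obtain ⟨a, ha⟩ := (hker v).1 h0
    exact hv a ha
  by_cases hu : IsUnit (h v)
  · obtain ⟨b, hb⟩ := hu.exists_left_inv
    exact ⟨b • v, by rw [map_smul, smul_eq_mul, hb]⟩
  obtain ⟨p, hp, hpg⟩ := WfDvdMonoid.exists_irreducible_factor hu hg0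
  replace hp := hp.prime
  exfalso
  have hcross : ∀ k, p ∣ crossProduct ρ v.1 k := fun k => by
    rw [hh]
    exact hpg.mul_right _
  choose c hc using hcross
  have hdvd : ∀ i k, p ∣ ρ i * v.1 k - v.1 i * ρ k := by
    have h0 := hc 0
    have h1 := hc 1
    have h2 := hc 2
    simp only [cross_apply, Matrix.cons_val] at h0 h1 h2
    intro i k
    refine ⟨![![0, c 2, - c 1], ![- c 2, 0, c 0], ![c 1, - c 0, 0]] i k, ?_⟩
    fin_cases i <;> fin_cases k <;>
      simp only [Fin.reduceFinMk, Fin.zero_eta, Fin.mk_one, Matrix.cons_val] <;> grind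
  obtain ⟨i, hi⟩ := hρ p hp
  replace hdvd := hdvd i
  choose w hw using hdvd
  have hpw : p • w = ρ i • v.1 - v.1 i • ρ := funext fun k => (hw k).symm
  have hwmem : w ∈ jacSyz f := mem_jacSyz_of_smul_mem hp.ne_zero <| by
    rw [hpw]
    exact sub_mem ((jacSyz f).smul_mem _ v.2) ((jacSyz f).smul_mem _ hρmem)
  obtain ⟨a, b, hab⟩ := hspan w hwmem
  have e1 : p • (a • (⟨ρ, hρmem⟩ : jacSyz f) + b • v) = ρ i • v - v.1 i • ⟨ρ, hρmem⟩ :=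
    Subtype.ext (by
      rw [← hab] at hpw
      exact hpw)
  have e2 := congrArg h e1
  simp only [map_smul, map_add, map_sub, hρ1, smul_eq_mul, mul_zero, zero_add, sub_zero] at e2
  exact hi ⟨b, mul_right_cancel₀ hg0 (by rw [← e2, mul_assoc])⟩

lemma isFreeWith_of_apply_eq_one {f : S3} {r s : ℕ} {ρ : Fin 3 → S3} (hρ0 : ρ ≠ 0)
    (hρmem : ρ ∈ jacSyz f) (hρr : ∀ i, (ρ i).IsHomogeneous r)
    {h : jacSyz f →ₗ[S3] S3} (hker : ∀ v : jacSyz f, h v = 0 ↔ ∃ a : S3, v.1 = a • ρ)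
    {v : jacSyz f} (hv : ∀ i, (v.1 i).IsHomogeneous s) (hv1 : h v = 1) (hrs : r ≤ s) :
    IsFreeWith f r s := by
  have hρ1 : h ⟨ρ, hρmem⟩ = 0 := (hker _).2 ⟨1, (one_smul _ _).symm⟩
  refine ⟨![ρ, v.1], ⟨?_, ?_, ?_, ?_, ?_, ?_⟩⟩
  · rw [Fin.forall_fin_two]
    exact ⟨hρmem, v.2⟩
  · rw [Fin.forall_fin_two]
    exact ⟨hρr, hv⟩
  · rw [Fin.forall_fin_two]
    refine ⟨hρ0, fun h0 => ?_⟩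
    rw [show v = 0 from Subtype.ext h0, map_zero] at hv1
    exact zero_ne_one hv1
  · apply le_antisymm
    · rw [Submodule.span_le]
      rintro _ ⟨j, rfl⟩
      fin_cases j
      exacts [hρmem, v.2]
    · intro w hw
      obtain ⟨a, ha⟩ := (hker (⟨w, hw⟩ - h ⟨w, hw⟩ • v)).1 (by
        rw [map_sub, map_smul, hv1, smul_eq_mul, mul_one, sub_self])
      rw [Matrix.range_cons_cons_empty, Submodule.mem_span_pair]
      exact ⟨a, h ⟨w, hw⟩, by rw [← ha]; exact sub_add_cancel w _⟩
  · have himage0 : ![ρ, v.1] '' {j' | j' ≠ 0} = {v.1} := by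
      ext w
      simp [Fin.exists_fin_two, eq_comm]
    have himage1 : ![ρ, v.1] '' {j' | j' ≠ 1} = {ρ} := by
      ext w
      simp [Fin.exists_fin_two, eq_comm]
    rw [Fin.forall_fin_two, himage0, himage1]
    simp only [Submodule.mem_span_singleton, Matrix.cons_val]
    constructor
    · rintro ⟨a, ha⟩
      have e := congrArg h (show a • v = ⟨ρ, hρmem⟩ from Subtype.ext ha)
      rw [map_smul, hv1, hρ1, smul_eq_mul, mul_one] at e
      exact hρ0 (by rw [← ha, e, zero_smul])
    · rintro ⟨a, ha⟩
      exact one_ne_zero (hv1.symm.trans ((hker v).2 ⟨a, ha.symm⟩))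
  · intro i j hij
    fin_cases i <;> fin_cases j <;> simp_all

lemma IsMinGenSyz.exists_smul_add_smul {f : S3} {dd : Fin 2 → ℕ} {v : Fin 2 → Fin 3 → S3}
    (hv : IsMinGenSyz f 2 dd v) {w : Fin 3 → S3} (hw : w ∈ jacSyz f) :
    ∃ a b : S3, a • v 0 + b • v 1 = w := by
  rw [← hv.span_eq, Submodule.mem_span_range_iff_exists_fun] at hw
  obtain ⟨c, hc⟩ := hw
  exact ⟨c 0, c 1, by rw [← hc, Fin.sum_univ_two]⟩

/-- The smallest exponent of a free curve is `mdr(f)`. -/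
lemma IsMinGenSyz.eq_of_isMDR {f : S3} {d₁ d₂ r : ℕ} {v : Fin 2 → Fin 3 → S3}
    (hv : IsMinGenSyz f 2 ![d₁, d₂] v) (hmdr : IsMDR f r) : d₁ = r := by
  have h12 : d₁ ≤ d₂ := hv.mono (Fin.zero_le 1)
  refine le_antisymm ?_ (le_of_not_gt fun hlt =>
    hv.ne_zero 0 (hmdr.2 d₁ hlt _ (hv.mem 0) (hv.hom 0)))
  by_contra! hlt
  obtain ⟨ρ, hρmem, hρ0, hρr⟩ := hmdr.1
  obtain ⟨a, b, rfl⟩ := hv.exists_smul_add_smul hρmem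
  refine hρ0 (funext fun i => ?_)
  rw [← homogeneousComponent_eq_self (hρr i)]
  simp [homogeneousComponent_mul_of_lt (hv.hom 0 i) hlt,
    homogeneousComponent_mul_of_lt (hv.hom 1 i) (hlt.trans_le h12)]

/-- A reduced plane curve `C : f = 0` of degree `d ≥ 3` (not the union of `d` lines through
one point) with `r = mdr(f)` satisfies `τ(C) = (d-1)² - r(d-r-1)` if and only if `C` is
free; moreover in that case `2r < d`. -/
theorem statement1 (f : S3) (d r τ : ℕ) (hd : 3 ≤ d)
    (hhom : f.IsHomogeneous d) (hred : Squarefree f)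
    (hlines : ¬ IsUnionOfConcurrentLines f d)
    (hmdr : IsMDR f r) (htau : IsTjurina f τ) :
    ((τ : ℤ) = ((d : ℤ) - 1) ^ 2 - r * ((d : ℤ) - r - 1) ↔ IsFreeCurve f) ∧
    ((τ : ℤ) = ((d : ℤ) - 1) ^ 2 - r * ((d : ℤ) - r - 1) → 2 * r < d) := by
  have hprim := exists_not_dvd_gradient (by omega) hhom hred
  have hf0 : polyGradient f ≠ 0 := by
    obtain ⟨j, hj⟩ := hprim (X 0) (X_prime (R := ℂ) (i := (0 : Fin 3)))
    exact fun h => hj (h ▸ dvd_zero _)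
  have hforward : (τ : ℤ) = ((d : ℤ) - 1) ^ 2 - r * ((d : ℤ) - r - 1) →
      IsFreeCurve f ∧ 2 * r < d := by
    intro hτ
    obtain ⟨ρ, hρmem, hρ0, hρr⟩ := hmdr.1
    have hρ := exists_not_dvd_of_isMDR hhom hmdr hρmem hρ0 hρr
    obtain ⟨h, hh⟩ := exists_cross_eq_smul_gradient hprim hρmem
    have hker := eq_zero_iff_of_cross_eq_smul hf0 hρ hh
    have h1 := (tjurina_eq_iff (by omega) hhom hf0 hρ0 hρmem hρr hh hker htau).1 hτ
    obtain ⟨s, hs, v, hv, hv1⟩ := exists_isHomogeneous_of_one_mem_range hhom hf0 hρr hh h1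
    have hrs : r ≤ s := by
      by_contra! hlt
      have hv0 : v = 0 := Subtype.ext (hmdr.2 s hlt v.1 v.2 hv)
      rw [hv0, map_zero] at hv1
      exact zero_ne_one hv1
    exact ⟨⟨r, s, isFreeWith_of_apply_eq_one hρ0 hρmem hρr hker hv hv1 hrs⟩, by omega⟩
  refine ⟨⟨fun hτ => (hforward hτ).1, ?_⟩, fun hτ => (hforward hτ).2⟩
  rintro ⟨d₁, d₂, v, hv⟩
  obtain rfl := hv.eq_of_isMDR hmdr
  have hρr : ∀ i, (v 0 i).IsHomogeneous d₁ := hv.hom 0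
  have hρ := exists_not_dvd_of_isMDR hhom hmdr (hv.mem 0) (hv.ne_zero 0) hρr
  obtain ⟨h, hh⟩ := exists_cross_eq_smul_gradient hprim (hv.mem 0)
  have hker := eq_zero_iff_of_cross_eq_smul hf0 hρ hh
  refine (tjurina_eq_iff (by omega) hhom hf0 (hv.ne_zero 0) (hv.mem 0) hρr hh hker htau).2
    (one_mem_range_of_span_pair (hv.mem 0) hρ hh hker ⟨v 1, hv.mem 1⟩ (fun a ha => ?_)
      fun w hw => hv.exists_smul_add_smul hw)
  refine hv.minimal 1 ?_
  rw [show v 1 = a • v 0 from ha]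
  exact Submodule.smul_mem _ a (Submodule.subset_span ⟨0, by simp, rfl⟩)

end
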